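/- arXiv:1308.3086 — 2 statements merged into one kernel-verified Lean document; each statement's English description precedes it below -/
import Mathlib

section
/- For X vertical or with ⟨X,dt⟩ = 1, the Lie derivative of the complete lift satisfies L_{X̃} R̃ = (L_X R)~, and for any 1-form α on E, L_{α^v} R̃ = (−R⌟d α + d(Rα))^v, where (R⌟ω)(Y,Z) := ω(RY, Z) for a 2-form ω and the vertical lift of a 2-form ω = ½ω_{ij} dq^i∧dq^j + ω_{0i} dt∧dq^i is the (1,1) tensor ω^v = ω_{ij} ∂/∂p_j ⊗ dq^i + ω_{0j} ∂/∂p_j ⊗ dt on J¹τ*. -/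
noncomputable section

open scoped BigOperators

/- Coordinate model for the paper "Lifting geometric objects to the dual of the
first jet bundle of a bundle fibred over ℝ".

`EE n` is the total space of `τ : E → ℝ`, with coordinates `(t, qⁱ)`.
`MM n` is `J¹τ* = T*E/⟨dt⟩`, with coordinates `(t, qⁱ, pᵢ)`.
`TS n` is the extended dual `T*E`, with coordinates `(t, qⁱ, p₀, pᵢ)`.
Vector fields and 1-forms are given by their component functions (a vector
field on a vector space `V` is a map `V → V`, a covector field likewise via
the standard pairing). -/

abbrev EE (n : ℕ) : Type := ℝ × (Fin n → ℝ)
abbrev MM (n : ℕ) : Type := EE n × (Fin n → ℝ)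
abbrev TS (n : ℕ) : Type := EE n × (ℝ × (Fin n → ℝ))

/-- the coordinate direction `∂/∂t` (equally, the covector `dt`) on `E` -/
def edt {n : ℕ} : EE n := (1, 0)
/-- the coordinate direction `∂/∂qⁱ` (equally, the covector `dqⁱ`) on `E` -/
def eqv {n : ℕ} (i : Fin n) : EE n := (0, Pi.single i 1)

/-- pairing of a tangent vector and a covector on `E`, in coordinates -/
def pairE {n : ℕ} (u a : EE n) : ℝ := u.1 * a.1 + ∑ i, u.2 i * a.2 i

/-- pairing of a tangent vector and a covector on `J¹τ*`, in coordinates -/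
def pairM {n : ℕ} (u a : MM n) : ℝ := pairE u.1 a.1 + ∑ i, u.2 i * a.2 i

/-- the fibre-linear function `F_X` on `J¹τ*` associated to a vertical vector
field `X = Xⁱ ∂/∂qⁱ` on `E`:  `F_X(t,q,p) = pᵢ Xⁱ(t,q)` -/
def FX {n : ℕ} (X : EE n → EE n) : MM n → ℝ := fun m => ∑ i, m.2 i * (X m.1).2 i

/-- vertical lift `α^v = αᵢ ∂/∂pᵢ` of a 1-form `α` on `E` -/
def vlift1 {n : ℕ} (α : EE n → EE n) : MM n → MM n := fun m => ((0, 0), (α m.1).2)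

/-- complete lift `X̃ = X⁰ ∂/∂t + Xⁱ ∂/∂qⁱ - p_j (∂X^j/∂qⁱ) ∂/∂pᵢ`
of a vector field `X` on `E` (for `X` vertical or with `⟨X,dt⟩ = 1`) -/
def clift {n : ℕ} (X : EE n → EE n) : MM n → MM n :=
  fun m => (X m.1, fun i => - ∑ j, m.2 j * fderiv ℝ (fun e => (X e).2 j) m.1 (eqv i))

/-- Lie bracket of vector fields on a vector space -/
def vbracket {V : Type} [NormedAddCommGroup V] [NormedSpace ℝ V] (A B : V → V) : V → V :=
  fun x => fderiv ℝ B x (A x) - fderiv ℝ A x (B x)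

/-- the canonical 2-form `Θ = pᵢ dqⁱ ∧ dt` on `J¹τ*` -/
def Theta {n : ℕ} (m u v : MM n) : ℝ :=
  ∑ i, m.2 i * (u.1.2 i * v.1.1 - v.1.2 i * u.1.1)

/-- Lie derivative of a 2-form `ω` along a vector field `V`,
evaluated on constant vector fields `u`, `v` -/
def lieDer2 {n : ℕ} (V : MM n → MM n) (ω : MM n → MM n → MM n → ℝ) (m u v : MM n) : ℝ :=
  fderiv ℝ (fun x => ω x u v) m (V m) + ω m (fderiv ℝ V m u) v + ω m u (fderiv ℝ V m v)

/-- Lie derivative `L_X α` of a 1-form on `E`, as a covector field -/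
def lieDer1 {n : ℕ} (X α : EE n → EE n) (e : EE n) : EE n :=
  (fderiv ℝ (fun x => pairE edt (α x)) e (X e) + pairE (fderiv ℝ X e edt) (α e),
   fun i => fderiv ℝ (fun x => pairE (eqv i) (α x)) e (X e) + pairE (fderiv ℝ X e (eqv i)) (α e))

/-- Lie derivative `L_X S` of a type (1,1) tensor `S` along a vector field `X`,
evaluated on a constant vector field `u`:  `(L_X S)(u) = [X, S u] - S [X, u]` -/
def lieDerT {V : Type} [NormedAddCommGroup V] [NormedSpace ℝ V]
    (X : V → V) (S : V → V → V) : V → V → V :=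
  fun x u => fderiv ℝ (fun y => S y u) x (X x) - fderiv ℝ X x (S x u) + S x (fderiv ℝ X x u)

/-- the Nijenhuis torsion `N_S(u,v) = [Su,Sv] + S²[u,v] - S[Su,v] - S[u,Sv]`
of a type (1,1) tensor `S`, evaluated on constant vector fields -/
def nijT {V : Type} [NormedAddCommGroup V] [NormedSpace ℝ V]
    (S : V → V → V) (x u v : V) : V :=
  fderiv ℝ (fun y => S y v) x (S x u) - fderiv ℝ (fun y => S y u) x (S x v)
    + S x (fderiv ℝ (fun y => S y u) x v) - S x (fderiv ℝ (fun y => S y v) x u)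

/-- adjoint action `S(α)`, `⟨u, S(α)⟩ = ⟨S(u), α⟩`, of a (1,1) tensor on a 1-form -/
def adjS {n : ℕ} (S : EE n → EE n → EE n) (α : EE n → EE n) : EE n → EE n :=
  fun e => (pairE (S e edt) (α e), fun j => pairE (S e (eqv j)) (α e))

/-- vertical lift `S^v = pᵢ Sⁱ_j ∂/∂p_j` (a vector field on `J¹τ*`) of a (1,1) tensor -/
def vlift11 {n : ℕ} (S : EE n → EE n → EE n) : MM n → MM n :=
  fun m => ((0, 0), fun j => ∑ i, m.2 i * (S m.1 (eqv j)).2 i)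

/-- horizontal lift `S^h = pᵢ Sⁱ_j dq^j + pᵢ Sⁱ_0 dt` (a semi-basic 1-form on `J¹τ*`,
given as a covector field) of a (1,1) tensor -/
def hliftC {n : ℕ} (S : EE n → EE n → EE n) : MM n → MM n :=
  fun m => ((∑ i, m.2 i * (S m.1 edt).2 i, fun j => ∑ i, m.2 i * (S m.1 (eqv j)).2 i), 0)

/-- matrix entry `Sⁱ_j` of a (1,1) tensor on `E` -/
def Rij {n : ℕ} (S : EE n → EE n → EE n) (i j : Fin n) (e : EE n) : ℝ := (S e (eqv j)).2 i
/-- matrix entry `Sⁱ_0` of a (1,1) tensor on `E` -/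
def Ri0 {n : ℕ} (S : EE n → EE n → EE n) (i : Fin n) (e : EE n) : ℝ := (S e edt).2 i

/-- the complete lift `S̃` on `J¹τ*` of a (1,1) tensor `S` on `E` (with `S(dt) = 0`),
in coordinates:
`S̃ = Sⁱ_j (∂/∂qⁱ ⊗ dq^j + ∂/∂p_j ⊗ dpᵢ) + Sⁱ_0 ∂/∂qⁱ ⊗ dt`
`  + pᵢ(∂Sⁱ_j/∂q^k − ∂Sⁱ_k/∂q^j) ∂/∂p_j ⊗ dq^k + pᵢ(∂Sⁱ_k/∂t − ∂Sⁱ_0/∂q^k) ∂/∂p_k ⊗ dt` -/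
def tlift {n : ℕ} (S : EE n → EE n → EE n) : MM n → MM n → MM n :=
  fun m u =>
    ((0, fun i => (∑ j, Rij S i j m.1 * u.1.2 j) + Ri0 S i m.1 * u.1.1),
     fun j => (∑ i, Rij S i j m.1 * u.2 i)
       + (∑ k, (∑ i, m.2 i *
           (fderiv ℝ (Rij S i j) m.1 (eqv k) - fderiv ℝ (Rij S i k) m.1 (eqv j))) * u.1.2 k)
       + (∑ i, m.2 i *
           (fderiv ℝ (Rij S i j) m.1 edt - fderiv ℝ (Ri0 S i) m.1 (eqv j))) * u.1.1)

/-- exterior derivative of a 1-form `α` on `E`, evaluated on constant vector fields -/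
def dOne {n : ℕ} (α : EE n → EE n) (e a b : EE n) : ℝ :=
  fderiv ℝ (fun x => pairE b (α x)) e a - fderiv ℝ (fun x => pairE a (α x)) e b

/-- projection `ρ : T*E → J¹τ*` (forgetting `p₀`) -/
def rho {n : ℕ} (z : TS n) : MM n := (z.1, z.2.2)
/-- tangent map of `ρ` -/
def Trho {n : ℕ} (w : TS n) : MM n := (w.1, w.2.2)

/-- the complete lift `S̃_{T*}` of a (1,1) tensor `S` (with `S(dt)=0`) to `T*E`:
the expression of `tlift` plus the extra terms
`Sⁱ_0 ∂/∂p₀ ⊗ dpᵢ + pᵢ(∂Sⁱ_0/∂q^k − ∂Sⁱ_k/∂t) ∂/∂p₀ ⊗ dq^k` -/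
def tliftStar {n : ℕ} (S : EE n → EE n → EE n) : TS n → TS n → TS n :=
  fun z w =>
    ((0, fun i => (∑ j, Rij S i j z.1 * w.1.2 j) + Ri0 S i z.1 * w.1.1),
     ((∑ i, Ri0 S i z.1 * w.2.2 i)
        + ∑ k, (∑ i, z.2.2 i *
            (fderiv ℝ (Ri0 S i) z.1 (eqv k) - fderiv ℝ (Rij S i k) z.1 edt)) * w.1.2 k,
      fun j => (tlift S (rho z) (Trho w)).2 j))

/-- Lie derivative of a 1-form `θ` on `J¹τ*` along a vector field `Z`, as covector field -/
def lieDer1M {n : ℕ} (Z θ : MM n → MM n) (m : MM n) : MM n :=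
  ((fderiv ℝ (fun x => pairM ((edt : EE n), 0) (θ x)) m (Z m)
      + pairM (fderiv ℝ Z m ((edt : EE n), 0)) (θ m),
    fun i => fderiv ℝ (fun x => pairM ((eqv i : EE n), 0) (θ x)) m (Z m)
      + pairM (fderiv ℝ Z m ((eqv i : EE n), 0)) (θ m)),
   fun i => fderiv ℝ (fun x => pairM (0, Pi.single i 1) (θ x)) m (Z m)
      + pairM (fderiv ℝ Z m (0, Pi.single i 1)) (θ m))

/-- adjoint action of a (1,1) tensor on `J¹τ*` on a 1-form `σ` -/
def adjM {n : ℕ} (T : MM n → MM n → MM n) (σ : MM n → MM n) : MM n → MM n :=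
  fun m => ((pairM (T m ((edt : EE n), 0)) (σ m), fun i => pairM (T m ((eqv i : EE n), 0)) (σ m)),
            fun i => pairM (T m (0, Pi.single i 1)) (σ m))

/-- the canonical Poisson map `P : Ω¹(J¹τ*) → X(J¹τ*)` of `Λ = ∂/∂qⁱ ∧ ∂/∂pᵢ`,
determined by `Λ(σ,τ) = ⟨P(σ), τ⟩` -/
def Pmap {n : ℕ} (σ : MM n → MM n) : MM n → MM n :=
  fun m => ((0, fun i => -(σ m).2 i), fun i => (σ m).1.2 i)

/-- the differential `dF_X` as a covector field on `J¹τ*` -/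
def dFc {n : ℕ} (X : EE n → EE n) (m : MM n) : MM n :=
  ((fderiv ℝ (FX X) m ((edt : EE n), 0), fun i => fderiv ℝ (FX X) m ((eqv i : EE n), 0)),
   fun i => fderiv ℝ (FX X) m (0, Pi.single i 1))

lemma two_le_inf : (2 : WithTop ℕ∞) ≤ ((⊤ : ℕ∞) : WithTop ℕ∞) := by
  have h : ((2 : ℕ∞) : WithTop ℕ∞) ≤ ((⊤ : ℕ∞) : WithTop ℕ∞) := WithTop.coe_le_coe.2 le_top
  exact h

lemma one_add_one_le_inf : (1 : WithTop ℕ∞) + 1 ≤ ((⊤ : ℕ∞) : WithTop ℕ∞) := by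
  rw [one_add_one_eq_two]; exact two_le_inf

/-- the fibre pairing `p ↦ (w ↦ pᵢ wⁱ)` as a continuous bilinear map -/
def HH (n : ℕ) : (Fin n → ℝ) →L[ℝ] (EE n →L[ℝ] ℝ) :=
  LinearMap.toContinuousLinearMap
    ((LinearMap.toContinuousLinearMap : (EE n →ₗ[ℝ] ℝ) ≃ₗ[ℝ] _).toLinearMap ∘ₗ
      LinearMap.mk₂ ℝ (fun (p : Fin n → ℝ) (w : EE n) => ∑ i, p i * w.2 i)
        (by intro a b c; simp [add_mul, Finset.sum_add_distrib])
        (by intro a b c; simp [mul_assoc, Finset.mul_sum])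
        (by intro a b c; simp [mul_add, Finset.sum_add_distrib])
        (by intro a b c; simp [mul_left_comm, Finset.mul_sum]))

lemma HH_apply {n : ℕ} (p : Fin n → ℝ) (w : EE n) : HH n p w = ∑ i, p i * w.2 i := rfl

lemma EE_decomp {n : ℕ} (u : EE n) : u = u.1 • edt + ∑ k, u.2 k • eqv k := by
  ext i
  · simp [edt, eqv, Prod.fst_sum]
  · simp [edt, eqv, Prod.snd_sum, Finset.sum_apply, Pi.single_apply]

lemma HH_dual {n : ℕ} (φ : EE n →L[ℝ] ℝ) (w : EE n) (hw : w.1 = 0) :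
    HH n (fun j => φ (eqv j)) w = φ w := by
  rw [HH_apply]
  conv_rhs => rw [EE_decomp w]
  simp [hw, mul_comm]

/-- invariant form of the complete lift -/
lemma tlift_eq {n : ℕ} (S : EE n → EE n → EE n) (A : EE n → EE n →L[ℝ] EE n)
    (hSA : ∀ e u, S e u = A e u) (hv : ∀ e u, (A e u).1 = 0)
    (hA : Differentiable ℝ A) (m u : MM n) :
    tlift S m u = (A m.1 u.1, fun j => HH n u.2 (A m.1 (eqv j))
      + HH n m.2 (fderiv ℝ A m.1 u.1 (eqv j) - fderiv ℝ A m.1 (eqv j) u.1)) := by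
  have hd : ∀ (w v : EE n) (i : Fin n),
      fderiv ℝ (fun e => (A e w).2 i) m.1 v = (fderiv ℝ A m.1 v w).2 i := by
    intro w v i
    have h1 := ((hA m.1).hasFDerivAt.clm_apply (hasFDerivAt_const w m.1)).snd
    have h2 := (hasFDerivAt_pi'.1 h1 i)
    rw [h2.fderiv]
    simp
  have h1 : ∀ i j, Rij S i j = fun e => (A e (eqv j)).2 i := by
    intro i j; funext e; simp [Rij, hSA]
  have h2 : ∀ i, Ri0 S i = fun e => (A e edt).2 i := by
    intro i; funext e; simp [Ri0, hSA]
  unfold tlift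
  simp only [h1, h2, hd]
  refine Prod.ext (Prod.ext ?_ ?_) ?_
  · simp [hv]
  · funext i
    conv_rhs => rw [EE_decomp u.1]
    simp [Prod.snd_sum, Finset.sum_apply, mul_comm, add_comm]
  · funext j
    have e1 : fderiv ℝ A m.1 u.1 (eqv j) = u.1.1 • fderiv ℝ A m.1 edt (eqv j)
        + ∑ k, u.1.2 k • fderiv ℝ A m.1 (eqv k) (eqv j) := by
      conv_lhs => rw [EE_decomp u.1]
      simp
    have e2 : fderiv ℝ A m.1 (eqv j) u.1 = u.1.1 • fderiv ℝ A m.1 (eqv j) edt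
        + ∑ k, u.1.2 k • fderiv ℝ A m.1 (eqv j) (eqv k) := by
      conv_lhs => rw [EE_decomp u.1]
      simp
    dsimp only
    rw [e1, e2]
    have e3 : ∀ a b, (∑ i, m.2 i * ((fderiv ℝ A m.1 a b).2 i - (fderiv ℝ A m.1 b a).2 i))
        = HH n m.2 (fderiv ℝ A m.1 a b) - HH n m.2 (fderiv ℝ A m.1 b a) := by
      intro a b; rw [← map_sub, HH_apply]; rfl
    simp only [e3]
    have e4 : (∑ i, (A m.1 (eqv j)).2 i * u.2 i) = HH n u.2 (A m.1 (eqv j)) := by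
      rw [HH_apply]; simp [mul_comm]
    rw [e4]
    simp only [map_sub, map_add, map_sum, map_smul, smul_eq_mul, sub_mul, Finset.sum_sub_distrib]
    simp only [mul_comm]
    ring

lemma tlift_fderiv {n : ℕ} (S : EE n → EE n → EE n) (A : EE n → EE n →L[ℝ] EE n)
    (hSA : ∀ e u, S e u = A e u) (hv : ∀ e u, (A e u).1 = 0)
    (hA : ContDiff ℝ (⊤ : ℕ∞) A) (m u w : MM n) :
    fderiv ℝ (fun y => tlift S y u) m w = (fderiv ℝ A m.1 w.1 u.1, fun j =>
      HH n u.2 (fderiv ℝ A m.1 w.1 (eqv j))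
      + HH n w.2 (fderiv ℝ A m.1 u.1 (eqv j) - fderiv ℝ A m.1 (eqv j) u.1)
      + HH n m.2 (fderiv ℝ (fderiv ℝ A) m.1 w.1 u.1 (eqv j)
          - fderiv ℝ (fderiv ℝ A) m.1 w.1 (eqv j) u.1)) := by
  have hA1 : Differentiable ℝ A := hA.differentiable (by simp)
  have hA2 : Differentiable ℝ (fderiv ℝ A) :=
    (hA.fderiv_right (m := 1) one_add_one_le_inf).differentiable (by simp)
  have hf : (fun y => tlift S y u) = _ := funext fun y => tlift_eq S A hSA hv hA1 y u
  rw [hf]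
  have d0 : HasFDerivAt (fun y : MM n => y.1) (ContinuousLinearMap.fst ℝ (EE n) (Fin n → ℝ)) m :=
    hasFDerivAt_fst
  have d0' : HasFDerivAt (fun y : MM n => y.2) (ContinuousLinearMap.snd ℝ (EE n) (Fin n → ℝ)) m :=
    hasFDerivAt_snd
  have d1 : HasFDerivAt (fun y : MM n => A y.1) _ m := (hA1 m.1).hasFDerivAt.comp m d0
  have d2 : HasFDerivAt (fun y : MM n => fderiv ℝ A y.1)
      ((fderiv ℝ (fderiv ℝ A) m.1).comp (ContinuousLinearMap.fst ℝ (EE n) (Fin n → ℝ))) m :=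
    HasFDerivAt.comp (g := fderiv ℝ A) m (hA2 m.1).hasFDerivAt d0
  have dA : ∀ v : EE n, HasFDerivAt (fun y : MM n => A y.1 v) _ m :=
    fun v => d1.clm_apply (hasFDerivAt_const v m)
  have dAA : ∀ v v' : EE n, HasFDerivAt (fun y : MM n => fderiv ℝ A y.1 v v') _ m :=
    fun v v' => (d2.clm_apply (hasFDerivAt_const v m)).clm_apply (hasFDerivAt_const v' m)
  have dH : HasFDerivAt (fun y : MM n => HH n y.2) _ m := (HH n).hasFDerivAt.comp m d0'
  have key := (dA u.1).prodMk (hasFDerivAt_pi.2 fun j =>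
    ((HH n u.2).hasFDerivAt.comp m (dA (eqv j))).add
      (dH.clm_apply ((dAA u.1 (eqv j)).sub (dAA (eqv j) u.1))))
  refine (congrArg (fun L => L w) key.fderiv).trans ?_
  refine Prod.ext ?_ (funext fun j => ?_)
  · simp
  · simp; ring

lemma clift_eq {n : ℕ} (X : EE n → EE n) (hX : Differentiable ℝ X) (m : MM n) :
    clift X m = (X m.1, fun i => - HH n m.2 (fderiv ℝ X m.1 (eqv i))) := by
  unfold clift
  refine Prod.ext rfl (funext fun i => ?_)
  simp only [HH_apply]
  congr 1
  refine Finset.sum_congr rfl fun j _ => ?_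
  rw [(hasFDerivAt_pi'.1 (hX m.1).hasFDerivAt.snd j).fderiv]
  simp

lemma clift_fderiv {n : ℕ} (X : EE n → EE n) (hX : ContDiff ℝ (⊤ : ℕ∞) X) (m w : MM n) :
    fderiv ℝ (clift X) m w = (fderiv ℝ X m.1 w.1, fun i =>
      - (HH n w.2 (fderiv ℝ X m.1 (eqv i))
        + HH n m.2 (fderiv ℝ (fderiv ℝ X) m.1 w.1 (eqv i)))) := by
  have hX1 : Differentiable ℝ X := hX.differentiable (by simp)
  have hX2 : Differentiable ℝ (fderiv ℝ X) :=
    (hX.fderiv_right (m := 1) one_add_one_le_inf).differentiable (by simp)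
  have hf : clift X = _ := funext fun y => clift_eq X hX1 y
  rw [hf]
  have d0 : HasFDerivAt (fun y : MM n => y.1) (ContinuousLinearMap.fst ℝ (EE n) (Fin n → ℝ)) m :=
    hasFDerivAt_fst
  have d0' : HasFDerivAt (fun y : MM n => y.2) (ContinuousLinearMap.snd ℝ (EE n) (Fin n → ℝ)) m :=
    hasFDerivAt_snd
  have d1 : HasFDerivAt (fun y : MM n => X y.1) _ m := (hX1 m.1).hasFDerivAt.comp m d0
  have d2 : HasFDerivAt (fun y : MM n => fderiv ℝ X y.1) _ m := (hX2 m.1).hasFDerivAt.comp m d0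
  have dH : HasFDerivAt (fun y : MM n => HH n y.2) _ m := (HH n).hasFDerivAt.comp m d0'
  have key := d1.prodMk (hasFDerivAt_pi.2 fun j =>
    (dH.clm_apply (d2.clm_apply (hasFDerivAt_const (eqv j) m))).neg)
  refine (congrArg (fun L => L w) key.fderiv).trans ?_
  refine Prod.ext ?_ (funext fun j => ?_)
  · simp
  · simp; ring

lemma pairE_eq {n : ℕ} (u a : EE n) (hu : u.1 = 0) : pairE u a = HH n a.2 u := by
  simp [pairE, HH_apply, hu, mul_comm]

lemma vlift1_fderiv {n : ℕ} (α : EE n → EE n) (hα1 : Differentiable ℝ α) (m w : MM n) :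
    fderiv ℝ (vlift1 α) m w = ((0, 0), (fderiv ℝ α m.1 w.1).2) := by
  have d1 : HasFDerivAt (fun y : MM n => α y.1)
      ((fderiv ℝ α m.1).comp (ContinuousLinearMap.fst ℝ (EE n) (Fin n → ℝ))) m :=
    HasFDerivAt.comp (g := α) m (hα1 m.1).hasFDerivAt hasFDerivAt_fst
  have key : HasFDerivAt (vlift1 α) _ m :=
    (hasFDerivAt_const ((0, 0) : EE n) m).prodMk d1.snd
  rw [key.fderiv]
  simp
  rfl

lemma pairE_fderiv {n : ℕ} (α : EE n → EE n) (hα1 : Differentiable ℝ α) (e b a : EE n) :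
    fderiv ℝ (fun x => pairE b (α x)) e a = pairE b (fderiv ℝ α e a) := by
  have h : ∀ x, pairE b x = (b.1 • ContinuousLinearMap.fst ℝ ℝ (Fin n → ℝ) + HH n b.2) x := by
    intro x; simp [pairE, HH_apply]
  simp only [h]
  exact congrArg (fun L => L a) (((b.1 • ContinuousLinearMap.fst ℝ ℝ (Fin n → ℝ)
    + HH n b.2).hasFDerivAt).comp e (hα1 e).hasFDerivAt).fderiv

lemma adjS_fderiv {n : ℕ} (R : EE n → EE n → EE n) (α : EE n → EE n)
    (A : EE n → EE n →L[ℝ] EE n)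
    (hSA : ∀ e u, R e u = A e u) (hv : ∀ e u, (A e u).1 = 0)
    (hA1 : Differentiable ℝ A) (hα1 : Differentiable ℝ α) (e b a : EE n) :
    fderiv ℝ (fun x => pairE b (adjS R α x)) e a
      = HH n (fderiv ℝ α e a).2 (A e b) + HH n (α e).2 (fderiv ℝ A e a b) := by
  have h : ∀ x, pairE b (adjS R α x) = HH n (α x).2 (A x b) := by
    intro x
    simp only [pairE, adjS, hSA]
    conv_rhs => rw [EE_decomp b]
    simp only [map_add, map_sum, map_smul, smul_eq_mul]
    simp only [HH_apply, hv, mul_comm, mul_zero, zero_add]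
  simp only [h]
  have d1 : HasFDerivAt (fun x => HH n (α x).2)
      ((HH n).comp ((ContinuousLinearMap.snd ℝ ℝ (Fin n → ℝ)).comp (fderiv ℝ α e))) e :=
    HasFDerivAt.comp (g := HH n) e (HH n).hasFDerivAt (hα1 e).hasFDerivAt.snd
  have d2 := d1.clm_apply ((hA1 e).hasFDerivAt.clm_apply (hasFDerivAt_const b e))
  rw [d2.fderiv]
  simp
  ring

set_option maxHeartbeats 1000000 in
/-- For `X` vertical or with `⟨X,dt⟩ = 1`, `L_{X̃} R̃ = (L_X R)~`,
and for any 1-form `α` on `E`, `L_{α^v} R̃ = (−R⌟dα + d(Rα))^v`, where the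
vertical lift of a 2-form `ω` on `E` is the (1,1) tensor whose value on `u` is
the `∂/∂p_j`-vector with components `ω(u, ∂/∂q^j)`. -/
theorem statement15 {n : ℕ} (R : EE n → EE n → EE n)
    (hRl : ∀ e, IsLinearMap ℝ (R e)) (hRv : ∀ e u, (R e u).1 = 0)
    (hRs : ∀ u, ContDiff ℝ (⊤ : ℕ∞) (fun e => R e u)) :
    (∀ X : EE n → EE n, ContDiff ℝ (⊤ : ℕ∞) X →
      ((∀ e, (X e).1 = 0) ∨ (∀ e, (X e).1 = 1)) →
      ∀ m u : MM n, lieDerT (clift X) (tlift R) m u = tlift (lieDerT X R) m u) ∧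
    (∀ α : EE n → EE n, ContDiff ℝ (⊤ : ℕ∞) α →
      ∀ m u : MM n, lieDerT (vlift1 α) (tlift R) m u
        = ((0, 0), fun j =>
            - dOne α m.1 (R m.1 u.1) (eqv j) + dOne (adjS R α) m.1 u.1 (eqv j))) := by
  obtain ⟨A, hSA⟩ : ∃ A : EE n → EE n →L[ℝ] EE n, ∀ e u, R e u = A e u :=
    ⟨fun e => LinearMap.toContinuousLinearMap (hRl e).mk', fun e u => rfl⟩
  have hv : ∀ e u, (A e u).1 = 0 := fun e u => by rw [← hSA, hRv]
  have hA : ContDiff ℝ (⊤ : ℕ∞) A := by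
    rw [contDiff_clm_apply_iff]
    intro u
    simpa only [hSA] using hRs u
  have hA1 : Differentiable ℝ A := hA.differentiable (by simp)
  have hA2 : Differentiable ℝ (fderiv ℝ A) :=
    (hA.fderiv_right (m := 1) one_add_one_le_inf).differentiable (by simp)
  have hRA : ∀ u, (fun e => R e u) = fun e => A e u := fun u => funext fun e => hSA e u
  have dA : ∀ (e u : EE n), HasFDerivAt (fun x => A x u) _ e :=
    fun e u => (hA1 e).hasFDerivAt.clm_apply (hasFDerivAt_const u e)
  have dA' : ∀ (e u v : EE n), fderiv ℝ (fun x => A x u) e v = fderiv ℝ A e v u := by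
    intro e u v
    rw [(dA e u).fderiv]; simp
  have hv' : ∀ e v u, (fderiv ℝ A e v u).1 = 0 := by
    intro e v u
    have h := (dA e u).fst
    have h2 : (fun x => (A x u).1) = fun _ => (0 : ℝ) := funext fun x => hv x u
    rw [h2] at h
    have h3 := congrArg (fun L => L v) (h.unique (hasFDerivAt_const (0 : ℝ) e))
    simpa using h3
  have symA : ∀ e a b c, fderiv ℝ (fderiv ℝ A) e a b c = fderiv ℝ (fderiv ℝ A) e b a c := by
    intro e a b c
    have := (hA.contDiffAt (x := e)).isSymmSndFDerivAt (by simpa using two_le_inf)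
    rw [this.eq a b]
  constructor
  · intro X hX hX1 m u
    have hXd : Differentiable ℝ X := hX.differentiable (by simp)
    have hX2 : Differentiable ℝ (fderiv ℝ X) :=
      (hX.fderiv_right (m := 1) one_add_one_le_inf).differentiable (by simp)
    have symX : ∀ e a b, fderiv ℝ (fderiv ℝ X) e a b = fderiv ℝ (fderiv ℝ X) e b a := by
      intro e a b
      have := (hX.contDiffAt (x := e)).isSymmSndFDerivAt (by simpa using two_le_inf)
      rw [this.eq a b]
    have hXv : ∀ e v, (fderiv ℝ X e v).1 = 0 := by
      intro e v
      have h := (hXd e).hasFDerivAt.fst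
      obtain ⟨c, hc⟩ : ∃ c : ℝ, (fun x => (X x).1) = fun _ => c := by
        rcases hX1 with h | h
        · exact ⟨0, funext h⟩
        · exact ⟨1, funext h⟩
      rw [hc] at h
      have h3 := congrArg (fun L => L v) (h.unique (hasFDerivAt_const c e))
      simpa using h3
    have dB : ∀ e, HasFDerivAt (fun e => fderiv ℝ A e (X e) - (fderiv ℝ X e).comp (A e)
        + (A e).comp (fderiv ℝ X e)) _ e := fun e =>
      (((hA2 e).hasFDerivAt.clm_apply (hXd e).hasFDerivAt).sub
        ((hX2 e).hasFDerivAt.clm_comp (hA1 e).hasFDerivAt)).add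
        ((hA1 e).hasFDerivAt.clm_comp (hX2 e).hasFDerivAt)
    have hB : ∀ e u, lieDerT X R e u = (fderiv ℝ A e (X e) - (fderiv ℝ X e).comp (A e)
        + (A e).comp (fderiv ℝ X e)) u := by
      intro e u
      simp [lieDerT, dA', hSA]
    rw [tlift_eq _ _ hB (by intro e u; simp [hv, hv', hXv]) (fun e => (dB e).differentiableAt),
      (dB m.1).fderiv]
    unfold lieDerT
    rw [tlift_fderiv R A hSA hv hA, clift_fderiv X hX, clift_fderiv X hX,
      tlift_eq R A hSA hv hA1, tlift_eq R A hSA hv hA1, clift_eq X hXd]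
    refine Prod.ext ?_ (funext fun j => ?_)
    · simp
    · -- the dual identities
      have q1 : ∀ w : EE n, w.1 = 0 →
          HH n (fun i => - HH n m.2 (fderiv ℝ X m.1 (eqv i))) w
            = - HH n m.2 (fderiv ℝ X m.1 w) := by
        intro w hw
        exact HH_dual (-((HH n m.2).comp (fderiv ℝ X m.1))) w hw
      have q2 : ∀ w : EE n, w.1 = 0 →
          HH n (fun j => HH n u.2 (A m.1 (eqv j))
            + HH n m.2 (fderiv ℝ A m.1 u.1 (eqv j) - fderiv ℝ A m.1 (eqv j) u.1)) w
            = HH n u.2 (A m.1 w)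
            + HH n m.2 (fderiv ℝ A m.1 u.1 w - fderiv ℝ A m.1 w u.1) := by
        intro w hw
        exact HH_dual ((HH n u.2).comp (A m.1) + (HH n m.2).comp
          (fderiv ℝ A m.1 u.1 - (fderiv ℝ A m.1).flip u.1)) w hw
      have q3 : ∀ w : EE n, w.1 = 0 →
          HH n (fun i => - (HH n u.2 (fderiv ℝ X m.1 (eqv i))
            + HH n m.2 (fderiv ℝ (fderiv ℝ X) m.1 u.1 (eqv i)))) w
            = - (HH n u.2 (fderiv ℝ X m.1 w)
            + HH n m.2 (fderiv ℝ (fderiv ℝ X) m.1 u.1 w)) := by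
        intro w hw
        exact HH_dual (-((HH n u.2).comp (fderiv ℝ X m.1)
          + (HH n m.2).comp (fderiv ℝ (fderiv ℝ X) m.1 u.1))) w hw
      simp only [Prod.snd_add, Prod.snd_sub, Pi.add_apply, Pi.sub_apply]
      rw [q1 _ (by simp [hv']), q2 _ (hXv _ _), q3 _ (hv _ _)]
      simp only [symA m.1 (X m.1)]
      simp
      rw [symX m.1 (eqv j) u.1, symX m.1 (eqv j) (A m.1 u.1)]
      ring
  · intro α hα m u
    have hα1 : Differentiable ℝ α := hα.differentiable (by simp)
    have dv := vlift1_fderiv α hα1 m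
    unfold lieDerT
    rw [tlift_fderiv R A hSA hv hA, dv, dv, tlift_eq R A hSA hv hA1, tlift_eq R A hSA hv hA1]
    have z0 : ((0, 0) : EE n) = 0 := rfl
    have dp := pairE_fderiv α hα1 m.1
    have dq := adjS_fderiv R α A hSA hv hA1 hα1 m.1
    refine Prod.ext ?_ (funext fun j => ?_)
    · simp [vlift1, z0]
    · have e1 : ∀ a : EE n, pairE (eqv j) a = a.2 j := by
        intro a; simp [pairE, eqv, Pi.single_apply]
      have e2 : ∀ a : EE n, pairE (A m.1 u.1) a = HH n a.2 (A m.1 u.1) :=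
        fun a => pairE_eq _ _ (hv _ _)
      simp only [dOne, dp, dq, hSA, vlift1]
      simp only [e1, e2, z0]
      simp
      ring
end
end

section
/- Let R be a (1,1) tensor on E with R(dt) = 0 and let R̃ be its complete lift to J¹τ*, with P the canonical Poisson map. Then the Magri-Morosi concomitant μ_{R̃,P}(σ,Z) = (L_{P(σ)} R̃)(Z) − P(L_Z(R̃(σ))) + P(L_{R̃(Z)} σ) vanishes identically, and consequently (P, R̃) is a Poisson-Nijenhuis structure on J¹τ* if and only if the Nijenhuis torsion N_R of R vanishes. -/
noncomputable section

open scoped BigOperators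

/-! ### Generic facts -/

section Generic

variable {V W : Type} [NormedAddCommGroup V] [NormedSpace ℝ V] [FiniteDimensional ℝ V]
  [NormedAddCommGroup W] [NormedSpace ℝ W]

theorem aux_expand (F : V → V → W) (hl : ∀ y, IsLinearMap ℝ (F y)) (y w : V) :
    F y w = ∑ i, (Module.finBasis ℝ V).repr w i • F y (Module.finBasis ℝ V i) := by
  conv_lhs => rw [← (Module.finBasis ℝ V).sum_repr w]
  have := map_sum (IsLinearMap.mk' (F y) (hl y))
    (fun i => (Module.finBasis ℝ V).repr w i • (Module.finBasis ℝ V i)) Finset.univ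
  simp only [IsLinearMap.mk'_apply] at this
  rw [this]
  exact Finset.sum_congr rfl fun i _ => (hl y).map_smul _ _

theorem aux_coord (i : Fin (Module.finrank ℝ V)) :
    ∃ L : V →L[ℝ] ℝ, ∀ w, L w = (Module.finBasis ℝ V).repr w i :=
  ⟨LinearMap.toContinuousLinearMap ((Module.finBasis ℝ V).coord i), fun _ => rfl⟩

theorem aux_contDiff (F : V → V → W) (hl : ∀ y, IsLinearMap ℝ (F y))
    (hs : ∀ w, ContDiff ℝ (⊤ : ℕ∞) (fun y => F y w)) (Z : V → V)
    (hZ : ContDiff ℝ (⊤ : ℕ∞) Z) : ContDiff ℝ (⊤ : ℕ∞) (fun y => F y (Z y)) := by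
  have : (fun y => F y (Z y)) = fun y => ∑ i, (Module.finBasis ℝ V).repr (Z y) i •
      F y (Module.finBasis ℝ V i) := funext fun y => aux_expand F hl y (Z y)
  rw [this]
  refine ContDiff.sum fun i _ => ContDiff.smul ?_ (hs _)
  obtain ⟨L, hL⟩ := aux_coord (V := V) i
  simp_rw [← hL]
  exact L.contDiff.comp hZ

theorem aux_fderiv (F : V → V → W) (hl : ∀ y, IsLinearMap ℝ (F y))
    (hs : ∀ w, ContDiff ℝ (⊤ : ℕ∞) (fun y => F y w)) (Z : V → V)
    (hZ : ContDiff ℝ (⊤ : ℕ∞) Z) (m b : V) :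
    fderiv ℝ (fun y => F y (Z y)) m b
      = fderiv ℝ (fun y => F y (Z m)) m b + F m (fderiv ℝ Z m b) := by
  choose L hL using aux_coord (V := V)
  have e (Z : V → V) : (fun y => F y (Z y)) = fun y => ∑ i, L i (Z y) •
      F y (Module.finBasis ℝ V i) := by
    funext y
    simp_rw [hL]
    exact aux_expand F hl y (Z y)
  have hd (w) : DifferentiableAt ℝ (fun y => F y w) m :=
    (hs w).differentiable (by simp) m
  have hZd : DifferentiableAt ℝ Z m := hZ.differentiable (by simp) m
  have key : HasFDerivAt (fun y => F y (Z y)) (∑ i, (L i (Z m) •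
      fderiv ℝ (fun y => F y (Module.finBasis ℝ V i)) m +
      ((L i).comp (fderiv ℝ Z m)).smulRight (F m (Module.finBasis ℝ V i)))) m := by
    rw [e]
    refine HasFDerivAt.fun_sum fun i _ => ?_
    exact ((L i).hasFDerivAt.comp m hZd.hasFDerivAt).smul (hd _).hasFDerivAt
  have key2 : HasFDerivAt (fun y => F y (Z m)) (∑ i, (L i (Z m) •
      fderiv ℝ (fun y => F y (Module.finBasis ℝ V i)) m)) m := by
    rw [e (fun _ => Z m)]
    exact HasFDerivAt.fun_sum fun i _ => (hd _).hasFDerivAt.const_smul _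
  rw [key.fderiv, key2.fderiv, aux_expand F hl m (fderiv ℝ Z m b)]
  simp [Finset.sum_add_distrib, hL]

theorem aux_clm (L : V → W) (hL : IsLinearMap ℝ L) {f : V → V}
    (hf : ContDiff ℝ (⊤ : ℕ∞) f) (m x : V) :
    fderiv ℝ (fun y => L (f y)) m x = L (fderiv ℝ f m x) := by
  have := aux_fderiv (fun _ => L) (fun _ => hL) (fun w => contDiff_const) f hf m x
  simpa using this

/-- exterior derivative of a 1-form `θ`, on constant fields -/
def dd (θ : V → V → ℝ) (m u v : V) : ℝ :=
  fderiv ℝ (fun y => θ y v) m u - fderiv ℝ (fun y => θ y u) m v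

theorem dd_antisymm (θ : V → V → ℝ) (m u v : V) : dd θ m u v = - dd θ m v u := by
  simp [dd]

theorem dd_contDiff (θ : V → V → ℝ) (hs : ∀ w, ContDiff ℝ (⊤ : ℕ∞) (fun y => θ y w)) (u v : V) :
    ContDiff ℝ (⊤ : ℕ∞) (fun m => dd θ m u v) := by
  unfold dd
  exact (((hs v).fderiv_right (m := (⊤ : ℕ∞)) (by simp)).clm_apply contDiff_const).sub
    (((hs u).fderiv_right (m := (⊤ : ℕ∞)) (by simp)).clm_apply contDiff_const)

theorem dd_linear (θ : V → V → ℝ) (hl : ∀ y, IsLinearMap ℝ (θ y))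
    (hs : ∀ w, ContDiff ℝ (⊤ : ℕ∞) (fun y => θ y w)) (m u : V) :
    IsLinearMap ℝ (dd θ m u) := by
  have hd (w) : DifferentiableAt ℝ (fun y => θ y w) m :=
    (hs w).differentiable (by simp) m
  constructor
  · intro v w
    simp only [dd, (hl _).map_add, map_add]
    rw [fderiv_fun_add (hd _) (hd _)]
    simp; ring
  · intro c v
    simp only [dd, (hl _).map_smul, map_smul]
    rw [fderiv_fun_const_smul (hd _)]
    simp; ring

theorem dd_closed (θ : V → V → ℝ) (hs : ∀ w, ContDiff ℝ (⊤ : ℕ∞) (fun y => θ y w)) (m u v w : V) :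
    fderiv ℝ (fun y => dd θ y v w) m u + fderiv ℝ (fun y => dd θ y w u) m v
      + fderiv ℝ (fun y => dd θ y u v) m w = 0 := by
  have h1 (a) : Differentiable ℝ (fderiv ℝ (fun y => θ y a)) :=
    ((hs a).fderiv_right (m := (⊤ : ℕ∞)) (by simp)).differentiable (by simp)
  have h2 (a b c : V) : fderiv ℝ (fun y => dd θ y a b) m c
      = fderiv ℝ (fderiv ℝ (fun y => θ y b)) m c a
        - fderiv ℝ (fderiv ℝ (fun y => θ y a)) m c b := by
    unfold dd
    have h3 (a b : V) : HasFDerivAt (fun y => fderiv ℝ (fun y => θ y b) y a)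
        ((fderiv ℝ (fderiv ℝ (fun y => θ y b)) m).flip a) m := by
      have := (h1 b m).hasFDerivAt.clm_apply (hasFDerivAt_const a m)
      simpa using this
    rw [((h3 a b).fun_sub (h3 b a)).fderiv]
    simp
  have h4 (a b c : V) : fderiv ℝ (fderiv ℝ (fun y => θ y a)) m b c
      = fderiv ℝ (fderiv ℝ (fun y => θ y a)) m c b :=
    ((hs a).contDiffAt.isSymmSndFDerivAt (by simp; exact (WithTop.coe_le_coe.2 (le_top : (2 : ℕ∞) ≤ ⊤)))).eq b c
  rw [h2, h2, h2, h4 w u v, h4 v u w, h4 u v w]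
  ring

end Generic

/-! ### The setting on `J¹τ*` -/

/-- the 1-form `pᵢ (R u)ⁱ` on `J¹τ*` -/
def th {n : ℕ} (R : EE n → EE n → EE n) (m u : MM n) : ℝ := ∑ i, m.2 i * (R m.1 u.1).2 i

/-- the fibrewise symplectic form -/
def om {n : ℕ} (u v : MM n) : ℝ := ∑ i, (u.1.2 i * v.2 i - u.2 i * v.1.2 i)

theorem om_antisymm {n : ℕ} (u v : MM n) : om u v = - om v u := by
  unfold om
  rw [← Finset.sum_neg_distrib]
  exact Finset.sum_congr rfl fun i _ => by ring

theorem om_linear_left {n : ℕ} (v : MM n) : IsLinearMap ℝ (fun u => om u v) := by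
  constructor
  · intro a b
    simp only [om, ← Finset.sum_add_distrib]
    exact Finset.sum_congr rfl fun i _ => by simp; ring
  · intro c a
    simp only [om, smul_eq_mul, Finset.mul_sum]
    exact Finset.sum_congr rfl fun i _ => by simp; ring

theorem om_linear_right {n : ℕ} (v : MM n) : IsLinearMap ℝ (fun u => om v u) := by
  constructor
  · intro a b
    simp only [om, ← Finset.sum_add_distrib]
    exact Finset.sum_congr rfl fun i _ => by simp; ring
  · intro c a
    simp only [om, smul_eq_mul, Finset.mul_sum]
    exact Finset.sum_congr rfl fun i _ => by simp; ring

theorem om_nondeg {n : ℕ} (W : MM n) (h0 : W.1.1 = 0)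
    (h : ∀ B : MM n, B.1.1 = 0 → om W B = 0) : W = 0 := by
  refine Prod.ext (Prod.ext h0 ?_) ?_
  · funext i
    have := h ((0, 0), Pi.single i 1) rfl
    simpa [om, Pi.single_apply] using this
  · funext i
    have := h ((0, Pi.single i 1), 0) rfl
    simpa [om, Pi.single_apply] using this

theorem EE_expand {n : ℕ} (u : EE n) : u = u.1 • edt + ∑ j, u.2 j • eqv j := by
  refine Prod.ext ?_ ?_
  · simp [edt, eqv, Prod.fst_sum]
  · funext i
    simp [edt, eqv, Prod.snd_sum, Pi.single_apply]

theorem lin_expand {n : ℕ} {W : Type} [AddCommGroup W] [Module ℝ W] (L : EE n → W)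
    (hL : IsLinearMap ℝ L) (u : EE n) : L u = u.1 • L edt + ∑ j, u.2 j • L (eqv j) := by
  have h := congrArg (IsLinearMap.mk' L hL) (EE_expand u)
  rw [map_add, map_smul, map_sum] at h
  simp only [map_smul] at h
  exact h

section Setting

variable {n : ℕ} {R : EE n → EE n → EE n}

theorem th_linear (hRl : ∀ e, IsLinearMap ℝ (R e))
    (m : MM n) : IsLinearMap ℝ (th R m) := by
  constructor
  · intro a b
    simp only [th, ← Finset.sum_add_distrib]
    exact Finset.sum_congr rfl fun i _ => by simp [(hRl _).map_add]; ring
  · intro c a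
    simp only [th, smul_eq_mul, Finset.mul_sum]
    exact Finset.sum_congr rfl fun i _ => by simp [(hRl _).map_smul]; ring

theorem R_smooth_comp (hRs : ∀ u, ContDiff ℝ (⊤ : ℕ∞) (fun e => R e u))
    (u : EE n) (i : Fin n) :
    ContDiff ℝ (⊤ : ℕ∞) (fun e => (R e u).2 i) := by
  have := hRs u
  fun_prop

theorem th_smooth (hRs : ∀ u, ContDiff ℝ (⊤ : ℕ∞) (fun e => R e u))
    (u : MM n) : ContDiff ℝ (⊤ : ℕ∞) (fun m => th R m u) := by
  unfold th
  refine ContDiff.sum fun i _ => ContDiff.mul (by fun_prop) ?_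
  exact (R_smooth_comp hRs u.1 i).comp contDiff_fst

theorem fderiv_R_comp (hRs : ∀ u, ContDiff ℝ (⊤ : ℕ∞) (fun e => R e u))
    (u e x : EE n) (i : Fin n) :
    fderiv ℝ (fun e => (R e u).2 i) e x = (fderiv ℝ (fun e => R e u) e x).2 i :=
  aux_clm (fun w : EE n => w.2 i) ⟨fun _ _ => rfl, fun _ _ => rfl⟩ (hRs u) e x

theorem fderiv_th (hRs : ∀ u, ContDiff ℝ (⊤ : ℕ∞) (fun e => R e u))
    (m u v : MM n) : fderiv ℝ (fun y => th R y v) m u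
    = ∑ i, (u.2 i * (R m.1 v.1).2 i + m.2 i * fderiv ℝ (fun e => (R e v.1).2 i) m.1 u.1) := by
  have h1 (i : Fin n) : HasFDerivAt (fun y : MM n => y.2 i)
      ((ContinuousLinearMap.proj i).comp (ContinuousLinearMap.snd ℝ (EE n) (Fin n → ℝ))) m :=
    ContinuousLinearMap.hasFDerivAt
      ((ContinuousLinearMap.proj (R := ℝ) (φ := fun _ : Fin n => ℝ) i).comp
        (ContinuousLinearMap.snd ℝ (EE n) (Fin n → ℝ)))
  have h2 (i : Fin n) : HasFDerivAt (fun y : MM n => (R y.1 v.1).2 i)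
      ((fderiv ℝ (fun e => (R e v.1).2 i) m.1).comp
        (ContinuousLinearMap.fst ℝ (EE n) (Fin n → ℝ))) m :=
    (((R_smooth_comp hRs v.1 i).differentiable (by simp) m.1).hasFDerivAt).comp m hasFDerivAt_fst
  have h3 := HasFDerivAt.fun_sum (u := Finset.univ) fun i _ => (h1 i).fun_mul (h2 i)
  have h4 : (fun y => th R y v) = fun y => ∑ i, y.2 i * (R y.1 v.1).2 i := rfl
  rw [h4, h3.fderiv]
  simp only [sum_apply]
  refine Finset.sum_congr rfl fun i _ => ?_
  simp
  ring

theorem R_comp_expand (hRl : ∀ e, IsLinearMap ℝ (R e))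
    (e u : EE n) (i : Fin n) :
    (R e u).2 i = (∑ j, Rij R i j e * u.2 j) + Ri0 R i e * u.1 := by
  have := congrArg (fun w : EE n => w.2 i) (lin_expand (R e) (hRl e) u)
  simp only [Prod.snd_add, Prod.smul_snd, Prod.snd_sum, Pi.add_apply, Pi.smul_apply,
    Finset.sum_apply, smul_eq_mul] at this
  rw [this, add_comm, mul_comm]
  congr 1
  exact Finset.sum_congr rfl fun j _ => mul_comm _ _

theorem tlift_fst (hRl : ∀ e, IsLinearMap ℝ (R e))
    (hRv : ∀ e u, (R e u).1 = 0)
    (m u : MM n) : (tlift R m u).1 = R m.1 u.1 := by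
  refine Prod.ext (hRv _ _).symm ?_
  funext i
  rw [R_comp_expand hRl]
  rfl

theorem tlift_snd (hRl : ∀ e, IsLinearMap ℝ (R e))
    (hRs : ∀ u, ContDiff ℝ (⊤ : ℕ∞) (fun e => R e u))
    (m u : MM n) (j : Fin n) :
    (tlift R m u).2 j = dd (th R) m u ((eqv j : EE n), 0) := by
  have hsm (i k) : DifferentiableAt ℝ (Rij R i k) m.1 :=
    (R_smooth_comp hRs (eqv k) i).differentiable (by simp) m.1
  have hsm0 (i) : DifferentiableAt ℝ (Ri0 R i) m.1 :=
    (R_smooth_comp hRs edt i).differentiable (by simp) m.1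
  have h1 (i : Fin n) : fderiv ℝ (fun e => (R e (eqv j)).2 i) m.1 u.1
      = u.1.1 * fderiv ℝ (Rij R i j) m.1 edt
        + ∑ k, u.1.2 k * fderiv ℝ (Rij R i j) m.1 (eqv k) :=
    lin_expand (fderiv ℝ (Rij R i j) m.1) ⟨map_add _, map_smul _⟩ u.1
  have h2 (i : Fin n) : fderiv ℝ (fun e => (R e u.1).2 i) m.1 (eqv j)
      = (∑ k, fderiv ℝ (Rij R i k) m.1 (eqv j) * u.1.2 k)
        + fderiv ℝ (Ri0 R i) m.1 (eqv j) * u.1.1 := by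
    have : (fun e => (R e u.1).2 i)
      = fun e => (∑ j, Rij R i j e * u.1.2 j) + Ri0 R i e * u.1.1 :=
      funext fun e => R_comp_expand hRl e u.1 i
    rw [this]
    have h3 := (HasFDerivAt.fun_sum (u := Finset.univ) fun k _ =>
      (hsm i k).hasFDerivAt.mul_const (u.1.2 k)).fun_add
        ((hsm0 i).hasFDerivAt.mul_const (u.1.1))
    rw [h3.fderiv]
    simp [mul_comm]
  unfold dd
  rw [fderiv_th hRs, fderiv_th hRs]
  simp only [h1, h2]
  have h5 : ∀ f : Fin n → Fin n → ℝ, (∑ k, (∑ i, m.2 i * f i k) * u.1.2 k)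
      = ∑ i, m.2 i * ∑ k, f i k * u.1.2 k := by
    intro f
    simp only [Finset.sum_mul, Finset.mul_sum]
    rw [Finset.sum_comm]
    simp only [mul_assoc]
  simp only [tlift, h5]
  rw [Finset.sum_mul, ← Finset.sum_add_distrib, ← Finset.sum_add_distrib,
    ← Finset.sum_sub_distrib]
  refine Finset.sum_congr rfl fun i _ => ?_
  have h6 : ∑ k, (fderiv ℝ (Rij R i j) m.1 (eqv k) - fderiv ℝ (Rij R i k) m.1 (eqv j)) * u.1.2 k
      = (∑ k, u.1.2 k * fderiv ℝ (Rij R i j) m.1 (eqv k))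
        - ∑ k, fderiv ℝ (Rij R i k) m.1 (eqv j) * u.1.2 k := by
    rw [← Finset.sum_sub_distrib]
    exact Finset.sum_congr rfl fun k _ => by ring
  rw [h6]
  simp only [Rij, Pi.zero_apply]
  ring

theorem om_tlift (hRl : ∀ e, IsLinearMap ℝ (R e))
    (hRv : ∀ e u, (R e u).1 = 0)
    (hRs : ∀ u, ContDiff ℝ (⊤ : ℕ∞) (fun e => R e u))
    (m u B : MM n) (hB : B.1.1 = 0) :
    om (tlift R m u) B = - dd (th R) m u B := by
  have hl := dd_linear (th R) (th_linear hRl) (th_smooth hRs) m u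
  have hp (i : Fin n) : (tlift R m u).1.2 i
      = - dd (th R) m u ((0 : EE n), Pi.single i 1) := by
    rw [tlift_fst hRl hRv]
    unfold dd
    rw [fderiv_th hRs, fderiv_th hRs]
    have h0 (e : EE n) : R e 0 = 0 := (hRl e).map_zero
    simp [h0, Pi.single_apply]
  have hB' : B = (∑ i, B.2 i • ((0 : EE n), (Pi.single i 1 : Fin n → ℝ)))
      + ∑ i, B.1.2 i • ((eqv i : EE n), (0 : Fin n → ℝ)) := by
    refine Prod.ext (Prod.ext ?_ ?_) ?_
    · simp [Prod.fst_sum, eqv, hB]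
    · funext i
      simp [Prod.fst_sum, Prod.snd_sum, eqv, Pi.single_apply]
    · funext i
      simp [Prod.snd_sum, Pi.single_apply]
  have h := congrArg (IsLinearMap.mk' _ hl) hB'
  rw [map_add, map_sum, map_sum] at h
  simp only [map_smul, IsLinearMap.mk'_apply, smul_eq_mul] at h
  rw [h, om, ← Finset.sum_add_distrib, ← Finset.sum_neg_distrib]
  refine Finset.sum_congr rfl fun i _ => ?_
  rw [hp, tlift_snd hRl hRs]
  ring

theorem tlift_linear (m : MM n) : IsLinearMap ℝ (tlift R m) := by
  constructor
  · intro a b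
    refine Prod.ext (Prod.ext (by simp [tlift]) ?_) ?_
    · funext i
      simp [tlift, mul_add, Finset.sum_add_distrib]; ring
    · funext i
      simp [tlift, mul_add, Finset.sum_add_distrib]; ring
  · intro c a
    refine Prod.ext (Prod.ext (by simp [tlift]) ?_) ?_
    · funext i
      simp [tlift, mul_add, Finset.mul_sum, mul_left_comm]
    · funext i
      simp [tlift, mul_add, Finset.mul_sum, mul_left_comm]

theorem tlift_smooth (hRl : ∀ e, IsLinearMap ℝ (R e))
    (hRv : ∀ e u, (R e u).1 = 0)
    (hRs : ∀ u, ContDiff ℝ (⊤ : ℕ∞) (fun e => R e u))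
    (u : MM n) : ContDiff ℝ (⊤ : ℕ∞) (fun m => tlift R m u) := by
  have h1 : (fun m : MM n => tlift R m u)
      = fun m => (R m.1 u.1, fun j => dd (th R) m u ((eqv j : EE n), 0)) := by
    funext m
    exact Prod.ext (tlift_fst hRl hRv m u) (funext fun j => tlift_snd hRl hRs m u j)
  rw [h1]
  refine ContDiff.prodMk ((hRs u.1).comp contDiff_fst) ?_
  exact contDiff_pi.2 fun j => dd_contDiff _ (th_smooth hRs) _ _

/-- the image of the derivative of `R̃` is vertical -/
theorem fderiv_tlift_vert (m u x : MM n) (hs : ContDiff ℝ (⊤ : ℕ∞) (fun m => tlift R m u)) :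
    (fderiv ℝ (fun y => tlift R y u) m x).1.1 = 0 := by
  have := aux_clm (fun w : MM n => w.1.1) ⟨fun _ _ => rfl, fun _ _ => rfl⟩ hs m x
  rw [← this]
  simp [tlift]

theorem om_fderiv_tlift (hRl : ∀ e, IsLinearMap ℝ (R e))
    (hRv : ∀ e u, (R e u).1 = 0)
    (hRs : ∀ u, ContDiff ℝ (⊤ : ℕ∞) (fun e => R e u))
    (m u x B : MM n) (hB : B.1.1 = 0) :
    om (fderiv ℝ (fun y => tlift R y u) m x) B
      = - fderiv ℝ (fun y => dd (th R) y u B) m x := by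
  rw [← aux_clm (fun w : MM n => om w B) (om_linear_left B) (tlift_smooth hRl hRv hRs u) m x]
  simp only [om_tlift hRl hRv hRs _ _ _ hB]
  simp

theorem om_tlift_symm (hRl : ∀ e, IsLinearMap ℝ (R e))
    (hRv : ∀ e u, (R e u).1 = 0)
    (hRs : ∀ u, ContDiff ℝ (⊤ : ℕ∞) (fun e => R e u))
    (m A B : MM n) (hA : A.1.1 = 0) (hB : B.1.1 = 0) :
    om (tlift R m A) B = om A (tlift R m B) := by
  rw [om_antisymm A, om_tlift hRl hRv hRs _ _ _ hA, om_tlift hRl hRv hRs _ _ _ hB, dd_antisymm]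

/-! ### The Nijenhuis torsion -/

theorem R2_smooth (hRl : ∀ e, IsLinearMap ℝ (R e))
    (hRs : ∀ u, ContDiff ℝ (⊤ : ℕ∞) (fun e => R e u))
    (u : EE n) : ContDiff ℝ (⊤ : ℕ∞) (fun e => R e (R e u)) :=
  aux_contDiff R hRl hRs _ (hRs u)

theorem fderiv_R2 (hRl : ∀ e, IsLinearMap ℝ (R e))
    (hRs : ∀ u, ContDiff ℝ (⊤ : ℕ∞) (fun e => R e u))
    (u e x : EE n) : fderiv ℝ (fun e => R e (R e u)) e x
    = fderiv ℝ (fun y => R y (R e u)) e x + R e (fderiv ℝ (fun y => R y u) e x) :=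
  aux_fderiv R hRl hRs _ (hRs u) e x

theorem dd_R2 (hRl : ∀ e, IsLinearMap ℝ (R e))
    (hRv : ∀ e u, (R e u).1 = 0)
    (hRs : ∀ u, ContDiff ℝ (⊤ : ℕ∞) (fun e => R e u))
    (hN : ∀ e u v : EE n, nijT R e u v = 0) (m u v : MM n) :
    dd (th R) m (tlift R m u) v = dd (th (fun e u => R e (R e u))) m u v := by
  have h1 : ∑ i, (tlift R m u).2 i * (R m.1 v.1).2 i
      = dd (th R) m u (R m.1 v.1, 0) := by
    have := om_tlift hRl hRv hRs m u (R m.1 v.1, 0) (hRv _ _)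
    simp [om] at this
    exact this
  have h2 : dd (th R) m (tlift R m u) v = dd (th R) m u (R m.1 v.1, 0)
      + (∑ i, m.2 i * fderiv ℝ (fun e => (R e v.1).2 i) m.1 (R m.1 u.1))
      - ∑ i, (v.2 i * (R m.1 (R m.1 u.1)).2 i
          + m.2 i * fderiv ℝ (fun e => (R e (R m.1 u.1)).2 i) m.1 v.1) := by
    rw [← h1, ← Finset.sum_add_distrib]
    unfold dd
    rw [fderiv_th hRs, fderiv_th hRs]
    simp only [tlift_fst hRl hRv]
  rw [h2]
  unfold dd
  rw [fderiv_th hRs, fderiv_th hRs, fderiv_th (R2_smooth hRl hRs), fderiv_th (R2_smooth hRl hRs)]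
  simp only [fderiv_R_comp hRs, fderiv_R_comp (R := fun e u => R e (R e u)) (R2_smooth hRl hRs)]
  simp only [fderiv_R2 hRl hRs]
  simp only [← Finset.sum_add_distrib, ← Finset.sum_sub_distrib]
  refine Finset.sum_congr rfl fun i _ => ?_
  have h3 := congrArg (fun w : EE n => w.2 i) (hN m.1 u.1 v.1)
  simp only [nijT, Prod.snd_add, Prod.snd_sub, Pi.add_apply, Pi.sub_apply, Prod.snd_zero,
    Pi.zero_apply] at h3 ⊢
  linear_combination m.2 i * h3

theorem nij_fst (hRl : ∀ e, IsLinearMap ℝ (R e))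
    (hRv : ∀ e u, (R e u).1 = 0)
    (hRs : ∀ u, ContDiff ℝ (⊤ : ℕ∞) (fun e => R e u))
    (m u v : MM n) : (nijT (tlift R) m u v).1 = nijT R m.1 u.1 v.1 := by
  have h (u x : MM n) : (fderiv ℝ (fun y => tlift R y u) m x).1
      = fderiv ℝ (fun e => R e u.1) m.1 x.1 := by
    rw [← aux_clm (fun w : MM n => (w.1, (0 : Fin n → ℝ))) ⟨fun a b => by simp, fun c a => by simp⟩
      (tlift_smooth hRl hRv hRs u) m x |> congrArg Prod.fst]
    have h1 : HasFDerivAt (fun y : MM n => ((tlift R y u).1, (0 : Fin n → ℝ)))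
        (((fderiv ℝ (fun e => R e u.1) m.1).comp
        (ContinuousLinearMap.fst ℝ (EE n) (Fin n → ℝ))).prod 0) m := by
      simp only [tlift_fst hRl hRv]
      refine HasFDerivAt.prodMk ?_ (hasFDerivAt_const _ _)
      exact (((hRs u.1).differentiable (by simp) m.1).hasFDerivAt).comp m hasFDerivAt_fst
    rw [h1.fderiv]
    simp
  simp only [nijT, Prod.fst_add, Prod.fst_sub, h, tlift_fst hRl hRv]

theorem nij_lift (hRl : ∀ e, IsLinearMap ℝ (R e))
    (hRv : ∀ e u, (R e u).1 = 0)
    (hRs : ∀ u, ContDiff ℝ (⊤ : ℕ∞) (fun e => R e u))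
    (hN : ∀ e u v : EE n, nijT R e u v = 0) (m u v : MM n) :
    nijT (tlift R) m u v = 0 := by
  have ths := th_smooth hRs
  have vT (m u : MM n) : (tlift R m u).1.1 = 0 := rfl
  have vD (m u x : MM n) := fderiv_tlift_vert m u x (tlift_smooth hRl hRv hRs u)
  refine om_nondeg _ (by simp [nij_fst hRl hRv hRs, hN]) fun B hB => ?_
  set T := tlift R m with hT
  -- derivative of `Ω(w, x)`
  let D : MM n → MM n → MM n → ℝ := fun a b c => fderiv ℝ (fun y => dd (th R) y b c) m a
  let K : MM n → MM n → MM n → ℝ := fun a b c =>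
    fderiv ℝ (fun y => dd (th (fun e u => R e (R e u))) y b c) m a
  have Dc (a b c) : D a b c + D b c a + D c a b = 0 := dd_closed (th R) ths m a b c
  have Kc (a b c) : K a b c + K b c a + K c a b = 0 :=
    dd_closed _ (th_smooth (R := fun e u => R e (R e u)) (R2_smooth hRl hRs)) m a b c
  have anti (a b c) : D a b c = - D a c b := by
    have : (fun y => dd (th R) y b c) = fun y => - dd (th R) y c b :=
      funext fun y => dd_antisymm _ _ _ _
    simp only [D]
    rw [this]
    simp
  have Kanti (a b c) : K a b c = - K a c b := by
    have : (fun y => dd (th (fun e u => R e (R e u))) y b c)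
        = fun y => - dd (th (fun e u => R e (R e u))) y c b :=
      funext fun y => dd_antisymm _ _ _ _
    simp only [K]
    rw [this]
    simp
  -- K in terms of D
  have KD (a b c) : K a b c = D a (T b) c + D a b (T c) := by
    have e1 : K a b c = fderiv ℝ (fun y => dd (th R) y (tlift R y b) c) m a := by
      simp only [K, dd_R2 hRl hRv hRs hN]
    have hl (y : MM n) : IsLinearMap ℝ (fun w => dd (th R) y w c) := by
      have h := dd_linear (th R) (th_linear hRl) ths y c
      have e : (fun w => dd (th R) y w c) = fun w => - dd (th R) y c w :=
        funext fun w => dd_antisymm _ _ _ _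
      rw [e]
      exact ⟨fun a b => by simp [h.map_add]; ring, fun r a => by simp [h.map_smul]⟩
    rw [e1, aux_fderiv (fun y w => dd (th R) y w c) hl (fun w => dd_contDiff _ ths _ _) _
      (tlift_smooth hRl hRv hRs b)]
    congr 1
    rw [dd_antisymm, ← om_tlift hRl hRv hRs _ _ _ (vD _ _ _), om_antisymm,
      om_fderiv_tlift hRl hRv hRs _ _ _ _ (vT _ _)]
    simp [D, hT]
  have L := om_linear_left B
  have e : om (nijT (tlift R) m u v) B
      = - D (T u) v B + D (T v) u B - D v u (T B) + D u v (T B) := by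
    unfold nijT
    rw [L.map_sub, L.map_add, L.map_sub]
    rw [om_tlift_symm hRl hRv hRs _ _ _ (vD _ _ _) hB,
      om_tlift_symm hRl hRv hRs _ _ _ (vD _ _ _) hB]
    simp only [om_fderiv_tlift hRl hRv hRs _ _ _ _ hB,
      om_fderiv_tlift hRl hRv hRs _ _ _ _ (vT _ _)]
    simp only [D, hT]
    ring
  rw [e]
  have k1 := KD u v B
  have k2 := KD v B u
  have k3 := KD B u v
  have k4 := Kc u v B
  have c1 := Dc (T u) v B
  have c2 := Dc (T v) B u
  have c3 := Dc (T B) u v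
  have a1 := anti (T v) u B
  have a2 := anti v u (T B)
  have a3 := anti v B (T u)
  have a4 := anti B (T u) v
  have a5 := anti B (T v) u
  have a6 := anti u (T v) B
  have a7 := anti u (T B) v
  have a8 := anti v (T B) u
  have a9 := anti (T u) v B
  have a10 := anti (T B) u v
  linarith

/-! ### The Magri-Morosi concomitant -/

theorem pairM_linear_left (a : MM n) : IsLinearMap ℝ (fun u => pairM u a) := by
  constructor
  · intro u v
    simp [pairM, pairE, add_mul, Finset.sum_add_distrib]; ring
  · intro c u
    simp [pairM, pairE, mul_add, Finset.mul_sum, mul_assoc]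

theorem pairM_linear_right (a : MM n) : IsLinearMap ℝ (pairM a) := by
  constructor
  · intro u v
    simp [pairM, pairE, mul_add, Finset.sum_add_distrib]; ring
  · intro c u
    simp [pairM, pairE, mul_add, Finset.mul_sum, mul_left_comm]

theorem om_Pmap (σ : MM n → MM n) (m B : MM n) (hB : B.1.1 = 0) :
    om (Pmap σ m) B = - pairM B (σ m) := by
  simp only [om, Pmap, pairM, pairE, hB, zero_mul, zero_add]
  rw [← Finset.sum_add_distrib, ← Finset.sum_neg_distrib]
  exact Finset.sum_congr rfl fun i _ => by ring

theorem MM_expand (B : MM n) : B = B.1.1 • ((edt : EE n), (0 : Fin n → ℝ))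
    + (∑ i, B.1.2 i • ((eqv i : EE n), (0 : Fin n → ℝ)))
    + ∑ i, B.2 i • ((0 : EE n), (Pi.single i 1 : Fin n → ℝ)) := by
  refine Prod.ext (Prod.ext ?_ ?_) ?_
  · simp [Prod.fst_sum, eqv, edt]
  · funext i
    simp [Prod.fst_sum, Prod.snd_sum, eqv, edt, Pi.single_apply]
  · funext i
    simp [Prod.snd_sum, Pi.single_apply]

theorem pairM_of_linear (L : MM n → ℝ) (hL : IsLinearMap ℝ L) (B : MM n) :
    pairM B ((L ((edt : EE n), 0), fun i => L ((eqv i : EE n), 0)),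
      fun i => L (0, Pi.single i 1)) = L B := by
  have h := congrArg (IsLinearMap.mk' L hL) (MM_expand B)
  rw [map_add, map_add, map_sum, map_sum] at h
  simp only [map_smul, IsLinearMap.mk'_apply, smul_eq_mul] at h
  rw [h]
  rfl

theorem pairM_adjM (σ : MM n → MM n) (m B : MM n) :
    pairM B (adjM (tlift R) σ m) = pairM (tlift R m B) (σ m) := by
  refine pairM_of_linear (fun B => pairM (tlift R m B) (σ m)) ?_ B
  have h := pairM_linear_left (σ m)
  have h2 := tlift_linear (R := R) m
  exact ⟨fun a b => by rw [h2.map_add, h.map_add], fun c a => by rw [h2.map_smul, h.map_smul]⟩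

theorem pairM_smooth (a : MM n) (f : MM n → MM n) (hf : ContDiff ℝ (⊤ : ℕ∞) f) :
    ContDiff ℝ (⊤ : ℕ∞) (fun y => pairM a (f y)) :=
  aux_contDiff (fun _ => pairM a) (fun _ => pairM_linear_right a) (fun _ => contDiff_const) f hf

theorem pairM_smooth_left (a : MM n) (f : MM n → MM n) (hf : ContDiff ℝ (⊤ : ℕ∞) f) :
    ContDiff ℝ (⊤ : ℕ∞) (fun y => pairM (f y) a) :=
  aux_contDiff (fun _ u => pairM u a) (fun _ => pairM_linear_left a) (fun _ => contDiff_const) f hf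

theorem pairM_lieDer1M (Z θ : MM n → MM n)
    (hθ : ∀ u, Differentiable ℝ (fun y => pairM u (θ y))) (m B : MM n) :
    pairM B (lieDer1M Z θ m) = fderiv ℝ (fun x => pairM B (θ x)) m (Z m)
      + pairM (fderiv ℝ Z m B) (θ m) := by
  refine pairM_of_linear (fun B => fderiv ℝ (fun x => pairM B (θ x)) m (Z m)
      + pairM (fderiv ℝ Z m B) (θ m)) ?_ B
  have h (y) := pairM_linear_left (θ y)
  constructor
  · intro a b
    simp only [(h _).map_add, map_add]
    rw [fderiv_fun_add (hθ _ _) (hθ _ _)]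
    simp; ring
  · intro c a
    simp only [(h _).map_smul, map_smul]
    rw [fderiv_fun_const_smul (hθ _ _)]
    simp; ring

theorem Pmap_smooth (σ : MM n → MM n) (hσ : ContDiff ℝ (⊤ : ℕ∞) σ) :
    ContDiff ℝ (⊤ : ℕ∞) (Pmap σ) := by
  unfold Pmap
  fun_prop

theorem Pmap_comm (hRl : ∀ e, IsLinearMap ℝ (R e))
    (hRv : ∀ e u, (R e u).1 = 0)
    (hRs : ∀ u, ContDiff ℝ (⊤ : ℕ∞) (fun e => R e u))
    (σ : MM n → MM n) (m : MM n) :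
    Pmap (adjM (tlift R) σ) m = tlift R m (Pmap σ m) := by
  rw [← sub_eq_zero]
  refine om_nondeg _ (by simp [Pmap, tlift]) fun B hB => ?_
  rw [(om_linear_left B).map_sub, om_Pmap _ _ _ hB, pairM_adjM,
    om_tlift_symm hRl hRv hRs _ _ _ rfl hB, om_Pmap _ _ _ rfl]
  ring

theorem mu_zero (hRl : ∀ e, IsLinearMap ℝ (R e))
    (hRv : ∀ e u, (R e u).1 = 0)
    (hRs : ∀ u, ContDiff ℝ (⊤ : ℕ∞) (fun e => R e u))
    (σ Z : MM n → MM n) (hσ : ContDiff ℝ (⊤ : ℕ∞) σ)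
    (hZ : ContDiff ℝ (⊤ : ℕ∞) Z) (m : MM n) :
    lieDerT (Pmap σ) (tlift R) m (Z m)
      - Pmap (lieDer1M Z (adjM (tlift R) σ)) m
      + Pmap (lieDer1M (fun y => tlift R y (Z y)) σ) m = 0 := by
  have hP := Pmap_smooth σ hσ
  have Ts := tlift_smooth hRl hRv hRs
  have vP (x : MM n) : (fderiv ℝ (Pmap σ) m x).1.1 = 0 := by
    rw [← aux_clm (fun w : MM n => w.1.1) ⟨fun _ _ => rfl, fun _ _ => rfl⟩ hP m x]
    simp [Pmap]
  have vD (u x : MM n) := fderiv_tlift_vert m u x (Ts u)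
  have vT (u : MM n) : (tlift R m u).1.1 = 0 := rfl
  refine om_nondeg _ ?_ fun B hB => ?_
  · simp [lieDerT, vP, vD, vT, Pmap]
  have L := om_linear_left B
  have bil : ∀ u, ContDiff ℝ (⊤ : ℕ∞) (fun y => pairM (tlift R y u) (σ y)) := fun u =>
    aux_contDiff (fun y w => pairM (tlift R y u) w) (fun _ => pairM_linear_right _)
      (fun w => pairM_smooth_left w _ (Ts u)) σ hσ
  have h1 : pairM B (lieDer1M Z (adjM (tlift R) σ) m)
      = pairM (fderiv ℝ (fun y => tlift R y B) m (Z m)) (σ m)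
        + pairM (tlift R m B) (fderiv ℝ σ m (Z m))
        + pairM (tlift R m (fderiv ℝ Z m B)) (σ m) := by
    rw [pairM_lieDer1M, pairM_adjM]
    · simp only [pairM_adjM]
      rw [aux_fderiv (fun y w => pairM (tlift R y B) w) (fun _ => pairM_linear_right _)
        (fun w => pairM_smooth_left w _ (Ts B)) σ hσ,
        aux_clm (fun u => pairM u (σ m)) (pairM_linear_left _) (Ts B)]
    · intro u
      simp only [pairM_adjM]
      exact (bil u).differentiable (by simp)
  have h2 : pairM B (lieDer1M (fun y => tlift R y (Z y)) σ m)
      = pairM B (fderiv ℝ σ m (tlift R m (Z m)))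
        + pairM (fderiv ℝ (fun y => tlift R y (Z m)) m B) (σ m)
        + pairM (tlift R m (fderiv ℝ Z m B)) (σ m) := by
    rw [pairM_lieDer1M _ _ fun u => (pairM_smooth u σ hσ).differentiable (by simp)]
    rw [aux_fderiv (tlift R) tlift_linear Ts Z hZ, (pairM_linear_left _).map_add,
      aux_clm (pairM B) (pairM_linear_right B) hσ]
    ring
  have h3 (C x : MM n) (hC : C.1.1 = 0) :
      pairM C (fderiv ℝ σ m x) = - om (fderiv ℝ (Pmap σ) m x) C := by
    rw [← aux_clm (pairM C) (pairM_linear_right C) hσ,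
      ← aux_clm (fun w => om w C) (om_linear_left C) hP]
    simp only [om_Pmap _ _ _ hC]
    simp
  have h4 (C : MM n) (hC : C.1.1 = 0) : pairM C (σ m) = om C (Pmap σ m) := by
    rw [om_antisymm, om_Pmap _ _ _ hC, neg_neg]
  rw [L.map_add, L.map_sub, om_Pmap _ _ _ hB, om_Pmap _ _ _ hB, h1, h2]
  unfold lieDerT
  rw [L.map_add, L.map_sub, om_tlift_symm hRl hRv hRs _ _ _ (vP _) hB, h3 _ _ hB, h3 _ _ (vT _),
    h4 _ (vD _ _), h4 _ (vD _ _), om_fderiv_tlift hRl hRv hRs _ _ _ _ hB,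
    om_fderiv_tlift hRl hRv hRs _ _ _ _ rfl, om_fderiv_tlift hRl hRv hRs _ _ _ _ rfl]
  have hc := dd_closed (th R) (th_smooth hRs) m (Pmap σ m) (Z m) B
  have ha : fderiv ℝ (fun y => dd (th R) y (Z m) (Pmap σ m)) m B
      = - fderiv ℝ (fun y => dd (th R) y (Pmap σ m) (Z m)) m B := by
    have : (fun y => dd (th R) y (Z m) (Pmap σ m)) = fun y => - dd (th R) y (Pmap σ m) (Z m) :=
      funext fun y => dd_antisymm _ _ _ _
    rw [this]
    simp
  linarith

end Setting

/-- For `R` a (1,1) tensor on `E` with `R(dt) = 0`, `R̃` its complete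
lift to `J¹τ*` and `P` the canonical Poisson map, the Magri-Morosi concomitant
`μ_{R̃,P}(σ,Z) = (L_{P(σ)} R̃)(Z) − P(L_Z(R̃(σ))) + P(L_{R̃(Z)} σ)` vanishes
identically; consequently `(P, R̃)` is a Poisson-Nijenhuis structure on `J¹τ*`
(i.e. `P ∘ R̃ = R̃ ∘ P`, `N_{R̃} = 0` and `μ_{R̃,P} = 0`) if and only if the
Nijenhuis torsion `N_R` of `R` vanishes. -/
theorem statement19 {n : ℕ} (R : EE n → EE n → EE n)
    (hRl : ∀ e, IsLinearMap ℝ (R e)) (hRv : ∀ e u, (R e u).1 = 0)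
    (hRs : ∀ u, ContDiff ℝ (⊤ : ℕ∞) (fun e => R e u)) :
    (∀ (σ Z : MM n → MM n), ContDiff ℝ (⊤ : ℕ∞) σ → ContDiff ℝ (⊤ : ℕ∞) Z →
      ∀ m : MM n,
        lieDerT (Pmap σ) (tlift R) m (Z m)
          - Pmap (lieDer1M Z (adjM (tlift R) σ)) m
          + Pmap (lieDer1M (fun y => tlift R y (Z y)) σ) m = 0) ∧
    (((∀ (σ : MM n → MM n) (m : MM n), Pmap (adjM (tlift R) σ) m = tlift R m (Pmap σ m)) ∧
      (∀ m u v : MM n, nijT (tlift R) m u v = 0) ∧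
      (∀ (σ Z : MM n → MM n), ContDiff ℝ (⊤ : ℕ∞) σ → ContDiff ℝ (⊤ : ℕ∞) Z →
        ∀ m : MM n,
          lieDerT (Pmap σ) (tlift R) m (Z m)
            - Pmap (lieDer1M Z (adjM (tlift R) σ)) m
            + Pmap (lieDer1M (fun y => tlift R y (Z y)) σ) m = 0))
      ↔ (∀ e u v : EE n, nijT R e u v = 0)) := by
  have hmu := fun σ Z hσ hZ m => mu_zero hRl hRv hRs σ Z hσ hZ m
  refine ⟨hmu, ?_, fun hN => ⟨Pmap_comm hRl hRv hRs, nij_lift hRl hRv hRs hN, hmu⟩⟩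
  rintro ⟨-, hT, -⟩ e u v
  have h := nij_fst hRl hRv hRs (e, 0) (u, 0) (v, 0)
  rw [hT] at h
  exact h.symm
end
end
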